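/- Let 0 ≤ p ≤ n. The spectrum of the self-adjoint operator □̃_p = ∂*∂ + ∂∂* on A²_{(p,0)}(ℂⁿ, e^{-|z|²}) consists exactly of the numbers m + p for m = 0, 1, 2, …; each m + p is an eigenvalue whose eigenspace has dimension binom(n+m−1, n−1) · binom(n, p). In particular, every monomial (p,0)-form z^α dz_J with |α| = m is an eigenvector of □̃_p with eigenvalue m + p. -/

import Mathlib

open MeasureTheory Filter Complex Finset

noncomputable section

/-- Points of `ℂⁿ`. -/
abbrev Cn (n : ℕ) := Fin n → ℂ

/-- A form with coefficients indexed by subsets of `{1,…,n}`; a `(p,0)`-form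
`Σ'_{|J|=p} u_J dz_J` is such a family supported on sets of cardinality `p`. -/
abbrev FormC (n : ℕ) := Finset (Fin n) → Cn n → ℂ

/-- The Fock weight `e^{-|z|²}` on `ℂⁿ`. -/
def fWt {n : ℕ} (z : Cn n) : ℝ := Real.exp (-(∑ j, ‖z j‖ ^ 2))

/-- Squared Fock norm `‖f‖² = ∫ |f|² e^{-|z|²} dλ`. -/
def fNormSq {n : ℕ} (f : Cn n → ℂ) : ℝ := ∫ z : Cn n, ‖f z‖ ^ 2 * fWt z

/-- Fock inner product `(f,g) = ∫ f ḡ e^{-|z|²} dλ`. -/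
def fInner {n : ℕ} (f g : Cn n → ℂ) : ℂ :=
  ∫ z : Cn n, f z * (starRingEnd ℂ) (g z) * fWt z

/-- Membership in the Fock space `A²(ℂⁿ, e^{-|z|²})`. -/
def MemF {n : ℕ} (f : Cn n → ℂ) : Prop :=
  Differentiable ℂ f ∧ Integrable (fun z : Cn n => ‖f z‖ ^ 2 * fWt z)

/-- The holomorphic partial derivative `∂f/∂z_j`. -/
def pdz {n : ℕ} (j : Fin n) (f : Cn n → ℂ) : Cn n → ℂ :=
  fun z => fderiv ℂ f z (Pi.single j 1)

/-- The sign `(-1)^{#{i ∈ J : i < j}}` arising from `dz_j ∧ dz_J`. -/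
def sgn {n : ℕ} (j : Fin n) (J : Finset (Fin n)) : ℂ :=
  (-1 : ℂ) ^ (J.filter (fun i => i < j)).card

/-- The operator `∂`: `(∂u)_L = Σ_{j ∈ L} ± ∂u_{L\{j}}/∂z_j`, i.e.
`∂u = Σ'_J Σ_j (∂u_J/∂z_j) dz_j ∧ dz_J`. -/
def dOp {n : ℕ} (u : FormC n) : FormC n :=
  fun L z => ∑ j ∈ L, sgn j (L.erase j) * pdz j (u (L.erase j)) z

/-- The adjoint `∂*`: `(∂*u)_K = Σ_{j ∉ K} ± z_j u_{K ∪ {j}}`, i.e.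
`∂*u = Σ'_K Σ_j z_j u_{jK} dz_K` on the Fock space. -/
def dStarOp {n : ℕ} (u : FormC n) : FormC n :=
  fun K z => ∑ j ∈ Kᶜ, sgn j K * (z j * u (insert j K) z)

/-- The complex Laplacian `□̃ = ∂*∂ + ∂∂*`. -/
def boxOp {n : ℕ} (u : FormC n) : FormC n :=
  fun J z => dStarOp (dOp u) J z + dOp (dStarOp u) J z

/-- All coefficients belong to the Fock space. -/
def MemA2 {n : ℕ} (u : FormC n) : Prop := ∀ J, MemF (u J)

/-- `u` is a `(p,0)`-form: only coefficients with `|J| = p` may be nonzero. -/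
def IsDeg {n : ℕ} (p : ℕ) (u : FormC n) : Prop :=
  ∀ J : Finset (Fin n), J.card ≠ p → u J = 0

/-- Squared norm of a form: `Σ'_J ‖u_J‖²`. -/
def formNormSq {n : ℕ} (u : FormC n) : ℝ := ∑ J : Finset (Fin n), fNormSq (u J)

/-- Inner product of forms: `Σ'_J (u_J, v_J)`. -/
def formInner {n : ℕ} (u v : FormC n) : ℂ := ∑ J : Finset (Fin n), fInner (u J) (v J)

/-- `u ∈ dom ∂`. -/
def domD {n : ℕ} (u : FormC n) : Prop := MemA2 u ∧ MemA2 (dOp u)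

/-- `u ∈ dom ∂*`. -/
def domDs {n : ℕ} (u : FormC n) : Prop := MemA2 u ∧ MemA2 (dStarOp u)

/-- `u ∈ dom □̃`: `u ∈ dom ∂ ∩ dom ∂*`, `∂u ∈ dom ∂*` and `∂*u ∈ dom ∂`. -/
def domBox {n : ℕ} (u : FormC n) : Prop :=
  domD u ∧ domDs u ∧ domDs (dOp u) ∧ domD (dStarOp u)

/-- The monomial `(p,0)`-form `z^α dz_J`. -/
def monoForm {n : ℕ} (α : Fin n → ℕ) (J : Finset (Fin n)) : FormC n :=
  fun K z => if K = J then ∏ i, z i ^ α i else 0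

open scoped ComplexConjugate

section Torus

local instance : MeasureSpace UnitAddCircle := ⟨AddCircle.haarAddCircle⟩

local instance : Measure.IsAddHaarMeasure (volume : Measure UnitAddCircle) :=
  inferInstanceAs (Measure.IsAddHaarMeasure AddCircle.haarAddCircle)

local instance : IsProbabilityMeasure (volume : Measure UnitAddCircle) :=
  inferInstanceAs (IsProbabilityMeasure AddCircle.haarAddCircle)

lemma integral_fourier_unitAddCircle (m : ℤ) :
    ∫ s : UnitAddCircle, fourier m s = if 0 = m then 1 else 0 := by
  have h := orthonormal_iff_ite.mp (orthonormal_fourier (T := (1 : ℝ))) 0 m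
  rw [ContinuousMap.inner_toLp] at h
  simp only [fourier_zero, map_one, mul_one] at h
  exact h

lemma fourier_apply_add (m : ℤ) (x y : UnitAddCircle) :
    fourier m (x + y) = fourier m x * fourier m y := by
  simp only [fourier_apply, smul_add, AddCircle.toCircle_add, Circle.coe_mul]

lemma norm_fourier_apply (m : ℤ) (x : UnitAddCircle) : ‖fourier m x‖ = 1 := by
  simp only [fourier_apply, Circle.norm_coe]

lemma fourier_one_pow (m : ℕ) (x : UnitAddCircle) : (fourier 1 x) ^ m = fourier (m : ℤ) x := by
  simp [fourier_apply, AddCircle.toCircle_nsmul]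

/-- The angular Fourier coefficient of an entire function, as a function of the base point. -/
lemma exists_integral_fourier_mul_entire {g : ℂ → ℂ} (hg : Differentiable ℂ g) (k : ℤ) :
    ∃ a : ℂ, ∀ w : ℂ, ∫ s : UnitAddCircle, fourier (-k) s * g (fourier 1 s * w)
      = if 0 ≤ k then a * w ^ k.toNat else 0 := by
  refine ⟨(k.toNat.factorial : ℂ)⁻¹ * iteratedDeriv k.toNat g 0, fun w => ?_⟩
  set b : ℕ → ℂ := fun m => (m.factorial : ℂ)⁻¹ * iteratedDeriv m g 0 with hb
  have hsum : ∀ z : ℂ, HasSum (fun m : ℕ => b m * z ^ m) (g z) := by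
    intro z
    have h := Complex.hasSum_taylorSeries_of_entire hg 0 z
    simp only [sub_zero, smul_eq_mul] at h
    have e : (fun m : ℕ => b m * z ^ m)
        = fun m : ℕ => (m.factorial : ℂ)⁻¹ * (z ^ m * iteratedDeriv m g 0) := by
      ext m
      simp only [hb]
      ring
    rwa [e]
  have hterm : ∀ (m : ℕ) (s : UnitAddCircle),
      fourier (-k) s * (b m * (fourier 1 s * w) ^ m) = b m * w ^ m * fourier ((m : ℤ) - k) s := by
    intro m s
    rw [mul_pow, fourier_one_pow, sub_eq_add_neg, fourier_add]
    ring
  have key := hasSum_integral_of_summable_integral_norm (μ := (volume : Measure UnitAddCircle))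
    (F := fun (m : ℕ) s => b m * w ^ m * fourier ((m : ℤ) - k) s)
    (fun m => Continuous.integrable_of_hasCompactSupport (by fun_prop)
      (HasCompactSupport.of_compactSpace _))
    (by
      simp only [norm_mul, norm_fourier_apply, mul_one, integral_const, probReal_univ, one_smul]
      simpa only [norm_mul] using (hsum w).summable.norm)
  have hfun : ∀ s : UnitAddCircle, ∑' m : ℕ, b m * w ^ m * fourier ((m : ℤ) - k) s
      = fourier (-k) s * g (fourier 1 s * w) := by
    intro s
    rw [← ((hsum (fourier 1 s * w)).mul_left (fourier (-k) s)).tsum_eq]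
    exact tsum_congr fun m => (hterm m s).symm
  simp only [hfun, integral_const_mul, integral_fourier_unitAddCircle] at key
  refine key.unique ?_
  split_ifs with hk
  · convert hasSum_single k.toNat ?_ using 1
    · rw [if_pos (by omega)]; simp [hb]
    · intro m hm
      rw [if_neg (by omega), mul_zero]
  · convert hasSum_zero using 2 with m
    rw [if_neg (by omega), mul_zero]

variable {n : ℕ}

/-- Coordinatewise rotation of `ℂⁿ` by a point of the torus. -/
def torusRot (t : UnitAddTorus (Fin n)) (z : Cn n) : Cn n := fun i => fourier 1 (t i) * z i

lemma continuous_torusRot :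
    Continuous fun q : UnitAddTorus (Fin n) × Cn n => torusRot q.1 q.2 := by
  unfold torusRot
  fun_prop

/-- The Fourier coefficient of `t ↦ f (e^{it} z)`. -/
def torusCoeff (f : Cn n → ℂ) (β : Fin n → ℤ) (z : Cn n) : ℂ :=
  ∫ t : UnitAddTorus (Fin n), UnitAddTorus.mFourier (-β) t * f (torusRot t z)

lemma mFourier_add_single (β : Fin n → ℤ) (t : UnitAddTorus (Fin n)) (j : Fin n)
    (s : UnitAddCircle) : UnitAddTorus.mFourier β (t + Pi.single j s)
      = UnitAddTorus.mFourier β t * fourier (β j) s := by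
  simp only [UnitAddTorus.mFourier, ContinuousMap.coe_mk, Pi.add_apply, fourier_apply_add,
    Finset.prod_mul_distrib]
  congr 1
  rw [Finset.prod_eq_single j]
  · simp
  · intro i _ hi
    rw [Pi.single_eq_of_ne hi, fourier_eval_zero]
  · simp

lemma torusRot_add_single (t : UnitAddTorus (Fin n)) (j : Fin n) (s : UnitAddCircle) (z : Cn n)
    (w : ℂ) : torusRot (t + Pi.single j s) (Function.update z j w)
      = Function.update (torusRot t z) j (fourier 1 (t j) * (fourier 1 s * w)) := by
  ext i
  by_cases hi : i = j
  · subst hi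
    simp only [torusRot, Pi.add_apply, Pi.single_eq_same, fourier_apply_add, Function.update_self]
    ring
  · simp [torusRot, Function.update_of_ne hi, Pi.single_eq_of_ne hi]

lemma torusCoeff_update_eq_integral {f : Cn n → ℂ} (hf : Continuous f) (β : Fin n → ℤ) (z : Cn n)
    (j : Fin n) (w : ℂ) : torusCoeff f β (Function.update z j w)
      = ∫ t : UnitAddTorus (Fin n), UnitAddTorus.mFourier (-β) t *
          ∫ s : UnitAddCircle, fourier (-β j) s *
            f (Function.update (torusRot t z) j (fourier 1 (t j) * (fourier 1 s * w))) := by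
  set G : UnitAddTorus (Fin n) → ℂ := fun t =>
    UnitAddTorus.mFourier (-β) t * f (torusRot t (Function.update z j w)) with hG
  have hGc : Continuous G := by
    have := continuous_torusRot (n := n)
    simp only [hG]
    fun_prop
  have hcomm : ∫ s : UnitAddCircle, ∫ t : UnitAddTorus (Fin n), G (t + Pi.single j s)
      = ∫ t : UnitAddTorus (Fin n), ∫ s : UnitAddCircle, G (t + Pi.single j s) := by
    apply integral_integral_swap
    apply Continuous.integrable_of_hasCompactSupport _ (HasCompactSupport.of_compactSpace _)
    have : Continuous fun s : UnitAddCircle =>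
      (Pi.single j s : UnitAddTorus (Fin n)) :=
      continuous_single (A := fun _ : Fin n => UnitAddCircle) j
    simp only [Function.uncurry_def]
    fun_prop
  have hleft : ∫ s : UnitAddCircle, ∫ t : UnitAddTorus (Fin n), G (t + Pi.single j s)
      = torusCoeff f β (Function.update z j w) := by
    simp_rw [integral_add_right_eq_self G]
    simp [torusCoeff, hG]
  rw [← hleft, hcomm]
  congr 1
  ext t
  rw [← integral_const_mul]
  congr 1
  ext s
  simp only [hG]
  rw [mFourier_add_single, torusRot_add_single, Pi.neg_apply, mul_assoc]

lemma torusCoeff_eq_update {f : Cn n → ℂ} (hf : Differentiable ℂ f) (β : Fin n → ℤ) (z : Cn n)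
    (j : Fin n) : torusCoeff f β z
      = if 0 ≤ β j then z j ^ (β j).toNat * torusCoeff f β (Function.update z j 1) else 0 := by
  have hg : ∀ t : UnitAddTorus (Fin n), Differentiable ℂ fun w : ℂ =>
      f (Function.update (torusRot t z) j (fourier 1 (t j) * w)) := by
    intro t
    apply hf.comp
    rw [differentiable_pi]
    intro i
    by_cases hi : i = j
    · subst hi
      simp only [Function.update_self]
      fun_prop
    · simp only [Function.update_of_ne hi]
      fun_prop
  choose a ha using fun t => exists_integral_fourier_mul_entire (hg t) (β j)
  have h1 := torusCoeff_update_eq_integral hf.continuous β z j (z j)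
  have h2 := torusCoeff_update_eq_integral hf.continuous β z j 1
  rw [Function.update_eq_self] at h1
  simp only [ha] at h1 h2
  split_ifs with hk
  · simp only [if_pos hk, one_pow] at h1 h2
    rw [h1, h2, ← integral_const_mul]
    congr 1
    ext t
    ring
  · simpa [if_neg hk] using h1

lemma torusCoeff_natCast {f : Cn n → ℂ} (hf : Differentiable ℂ f) (α : Fin n → ℕ) (z : Cn n) :
    torusCoeff f (fun i => (α i : ℤ)) z
      = (∏ i, z i ^ α i) * torusCoeff f (fun i => (α i : ℤ)) 1 := by
  have h : ∀ s : Finset (Fin n), torusCoeff f (fun i => (α i : ℤ)) z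
      = (∏ i ∈ s, z i ^ α i) * torusCoeff f (fun i => (α i : ℤ)) (s.piecewise 1 z) := by
    intro s
    induction s using Finset.induction_on with
    | empty => simp
    | insert j s hj ih =>
      rw [ih, torusCoeff_eq_update hf _ _ j, if_pos (by positivity), Finset.prod_insert hj,
        Finset.piecewise_insert, Finset.piecewise_eq_of_notMem _ _ _ hj]
      simp only [Int.toNat_natCast, Pi.one_apply]
      ring
  simpa using h Finset.univ

/-- `f` is the sum of the everywhere convergent power series with coefficients `c`. -/
def HasCoeff (f : Cn n → ℂ) (c : (Fin n → ℕ) → ℂ) : Prop :=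
  ∀ z : Cn n, HasSum (fun α : Fin n → ℕ => c α * ∏ i, z i ^ α i) (f z)

lemma injective_natCast_pi : Function.Injective fun (α : Fin n → ℕ) (i : Fin n) => (α i : ℤ) := by
  intro α β h
  ext i
  exact Int.natCast_inj.mp (congrFun h i)

lemma summable_prod_pow {r : Fin n → ℝ} (h0 : ∀ i, 0 ≤ r i) (h1 : ∀ i, r i < 1) :
    Summable fun α : Fin n → ℕ => ∏ i, r i ^ α i := by
  refine summable_of_sum_le (c := ∏ i, (1 - r i)⁻¹)
    (fun α => Finset.prod_nonneg fun i _ => pow_nonneg (h0 i) _) fun s => ?_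
  let N : ℕ := s.sup fun α => ∑ i, α i
  have hs : s ⊆ Fintype.piFinset fun _ : Fin n => Finset.range (N + 1) := by
    intro α hα
    rw [Fintype.mem_piFinset]
    intro i
    have h1 : ∑ i, α i ≤ N := Finset.le_sup (f := fun α : Fin n → ℕ => ∑ i, α i) hα
    have h2 : α i ≤ ∑ i, α i := Finset.single_le_sum (fun _ _ => Nat.zero_le _) (Finset.mem_univ i)
    rw [Finset.mem_range]
    omega
  calc ∑ α ∈ s, ∏ i, r i ^ α i
      ≤ ∑ α ∈ Fintype.piFinset fun _ : Fin n => Finset.range (N + 1), ∏ i, r i ^ α i :=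
        Finset.sum_le_sum_of_subset_of_nonneg hs
          fun α _ _ => Finset.prod_nonneg fun i _ => pow_nonneg (h0 i) _
    _ = ∏ i, ∑ k ∈ Finset.range (N + 1), r i ^ k := by rw [Finset.prod_univ_sum]
    _ ≤ ∏ i, (1 - r i)⁻¹ := by
        refine Finset.prod_le_prod
          (fun i _ => Finset.sum_nonneg fun k _ => pow_nonneg (h0 i) _) fun i _ => ?_
        rw [← tsum_geometric_of_lt_one (h0 i) (h1 i)]
        exact (summable_geometric_of_lt_one (h0 i) (h1 i)).sum_le_tsum _
          fun k _ => pow_nonneg (h0 i) _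

/-- Every entire function on `ℂⁿ` is the sum of its power series. -/
theorem Differentiable.exists_hasCoeff {f : Cn n → ℂ} (hf : Differentiable ℂ f) :
    ∃ c, HasCoeff f c := by
  refine ⟨fun α => torusCoeff f (fun i => (α i : ℤ)) 1, fun z => ?_⟩
  have hcont : ∀ z : Cn n, Continuous fun t : UnitAddTorus (Fin n) => f (torusRot t z) := by
    intro z
    have := hf.continuous
    unfold torusRot
    fun_prop
  let F : Cn n → C(UnitAddTorus (Fin n), ℂ) := fun z => ⟨fun t => f (torusRot t z), hcont z⟩
  have hF : ∀ z β, UnitAddTorus.mFourierCoeff (F z) β = torusCoeff f β z := fun z β => rfl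
  have hbound : ∀ z β, ‖torusCoeff f β z‖ ≤ ‖F z‖ := by
    intro z β
    have h := norm_integral_le_of_norm_le_const (μ := (volume : Measure (UnitAddTorus (Fin n))))
      (f := fun t => UnitAddTorus.mFourier (-β) t * f (torusRot t z)) (C := ‖F z‖)
      (Eventually.of_forall fun t => by
        rw [norm_mul]
        have h1 := (UnitAddTorus.mFourier (-β)).norm_coe_le_norm t
        have h2 := (F z).norm_coe_le_norm t
        rw [UnitAddTorus.mFourier_norm] at h1
        exact (mul_le_of_le_one_left (norm_nonneg _) h1).trans h2)
    simpa [torusCoeff] using h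
  have hzero : ∀ β : Fin n → ℤ, β ∉ Set.range (fun (α : Fin n → ℕ) (i : Fin n) => (α i : ℤ)) →
      torusCoeff f β z = 0 := by
    intro β hβ
    obtain ⟨j, hj⟩ : ∃ j, ¬ 0 ≤ β j := by
      by_contra! h
      exact hβ ⟨fun i => (β i).toNat, by ext i; simp [h i]⟩
    rw [torusCoeff_eq_update hf β z j, if_neg hj]
  have hsumm : Summable fun α : Fin n → ℕ => torusCoeff f (fun i => (α i : ℤ)) z := by
    refine Summable.of_norm_bounded (g := fun α => ‖F (fun i => 2 * z i)‖ * ∏ i, (1 / 2 : ℝ) ^ α i)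
      ((summable_prod_pow (by norm_num) (by norm_num)).mul_left _) fun α => ?_
    have h1 := hbound (fun i => 2 * z i) (fun i => (α i : ℤ))
    rw [torusCoeff_natCast hf] at h1 ⊢
    simp only [mul_pow, Finset.prod_mul_distrib] at h1
    simp only [norm_mul, norm_prod, norm_pow, Complex.norm_ofNat] at h1 ⊢
    simp only [one_div, inv_pow, Finset.prod_inv_distrib]
    rw [← div_eq_mul_inv, le_div_iff₀ (by positivity)]
    linarith
  have h := UnitAddTorus.hasSum_mFourier_series_apply_of_summable (f := F z)
    ((injective_natCast_pi.summable_iff hzero).mp hsumm) 0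
  have h0 : F z 0 = f z := by
    change f (torusRot 0 z) = f z
    congr 1
    ext i
    simp only [torusRot, Pi.zero_apply, fourier_eval_zero, one_mul]
  rw [h0] at h
  have h' := (injective_natCast_pi.hasSum_iff (fun β hβ => by
    rw [hF, hzero β hβ, zero_smul])).mpr h
  convert h' using 2 with α
  simp only [Function.comp_apply, hF]
  rw [torusCoeff_natCast hf α z]
  simp [UnitAddTorus.mFourier, mul_comm]

lemma Orthonormal.hasSum_norm_sq_of_hasSum {ι E : Type*} [NormedAddCommGroup E]
    [InnerProductSpace ℂ E] {e : ι → E} (he : Orthonormal ℂ e) {a : ι → ℂ} {x : E}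
    (h : HasSum (fun i => a i • e i) x) : HasSum (fun i => ‖a i‖ ^ 2) (‖x‖ ^ 2) := by
  classical
  have hin : ∀ j, inner ℂ (e j) x = a j := by
    intro j
    refine ((h.mapL (innerSL ℂ (e j))).unique ?_)
    have e : (fun i => innerSL ℂ (e j) (a i • e i)) = fun i => if i = j then a j else 0 := by
      ext i
      simp only [map_smul, innerSL_apply_apply, orthonormal_iff_ite.mp he, smul_eq_mul]
      by_cases hij : i = j
      · simp [hij]
      · simp [hij, Ne.symm hij]
    rw [e]
    exact hasSum_ite_eq j (a j)
  have h2 := Complex.hasSum_re (h.mapL (innerSL ℂ x))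
  simp only [map_smul, innerSL_apply_apply, smul_eq_mul] at h2
  convert h2 using 1
  · ext i
    rw [← inner_conj_symm, hin i, Complex.mul_conj, Complex.ofReal_re, Complex.normSq_eq_norm_sq]
  · rw [inner_self_eq_norm_sq_to_K]
    norm_cast

/-- Parseval's identity on the torus through `z`. -/
lemma HasCoeff.hasSum_torus {f : Cn n → ℂ} {c : (Fin n → ℕ) → ℂ} (h : HasCoeff f c)
    (z : Cn n) : HasSum (fun α : Fin n → ℕ => ‖c α * ∏ i, z i ^ α i‖ ^ 2)
      (∫ t : UnitAddTorus (Fin n), ‖f (torusRot t z)‖ ^ 2) ∧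
      Continuous fun t : UnitAddTorus (Fin n) => f (torusRot t z) := by
  have hs : Summable fun α : Fin n → ℕ => (c α * ∏ i, z i ^ α i) •
      UnitAddTorus.mFourier (fun i => (α i : ℤ)) := by
    refine Summable.of_norm ?_
    simpa only [norm_smul, UnitAddTorus.mFourier_norm, mul_one] using (h z).summable.norm
  obtain ⟨G, hG⟩ := hs
  have hGf : ∀ t, G t = f (torusRot t z) := by
    intro t
    have h1 := hG.mapL (ContinuousMap.evalCLM ℂ t)
    refine h1.unique ?_
    convert h (torusRot t z) using 2 with α
    simp only [map_smul, ContinuousMap.evalCLM_apply, UnitAddTorus.mFourier, torusRot,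
      ContinuousMap.coe_mk, mul_pow, Finset.prod_mul_distrib, fourier_one_pow, smul_eq_mul]
    ring
  have h2 := hG.mapL (ContinuousMap.toLp (E := ℂ) 2
    (volume : Measure (UnitAddTorus (Fin n))) ℂ)
  simp only [map_smul] at h2
  have h3 := (UnitAddTorus.orthonormal_mFourier.comp _
    (injective_natCast_pi (n := n))).hasSum_norm_sq_of_hasSum h2
  refine ⟨?_, by simpa only [← hGf] using G.continuous⟩
  convert h3 using 1
  have h4 := ContinuousMap.inner_toLp (𝕜 := ℂ) (volume : Measure (UnitAddTorus (Fin n))) G G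
  rw [inner_self_eq_norm_sq_to_K] at h4
  have h5 : ∀ t, G t * conj (G t) = ((‖f (torusRot t z)‖ ^ 2 : ℝ) : ℂ) := by
    intro t
    rw [hGf, Complex.mul_conj, Complex.normSq_eq_norm_sq]
  simp only [h5] at h4
  rw [integral_complex_ofReal] at h4
  exact Complex.ofReal_injective (by rw [← h4]; norm_cast)

lemma measurePreserving_torusRot (t : UnitAddTorus (Fin n)) :
    MeasurePreserving (torusRot t : Cn n → Cn n) := by
  refine volume_preserving_pi (fun i => ?_)
  have h : (fun w : ℂ => fourier 1 (t i) * w) = rotation (AddCircle.toCircle (t i)) := by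
    ext w
    rw [rotation_apply, fourier_one]
  change MeasurePreserving (fun w : ℂ => fourier 1 (t i) * w)
  rw [h]
  exact (rotation (AddCircle.toCircle (t i))).measurePreserving

lemma fWt_torusRot (t : UnitAddTorus (Fin n)) (z : Cn n) : fWt (torusRot t z) = fWt z := by
  simp only [fWt, torusRot, norm_mul, norm_fourier_apply, one_mul]

lemma fWt_nonneg (z : Cn n) : 0 ≤ fWt z := (Real.exp_pos _).le

lemma continuous_fWt : Continuous (fWt : Cn n → ℝ) := by
  unfold fWt
  fun_prop

/-- The squared Fock norm of the monomial `z^α`. -/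
def monoWt (α : Fin n → ℕ) : ℝ := ∏ i, (Real.pi * (α i).factorial)

lemma monoWt_pos (α : Fin n → ℕ) : 0 < monoWt α :=
  Finset.prod_pos fun i _ => by positivity

lemma lintegral_mono_sq (α : Fin n → ℕ) :
    ∫⁻ z : Cn n, ENNReal.ofReal (‖∏ i, z i ^ α i‖ ^ 2 * fWt z) = ENNReal.ofReal (monoWt α) := by
  have h1 : ∀ k : ℕ, ∫ w : ℂ, ‖w‖ ^ (2 * k) * Real.exp (-‖w‖ ^ 2) = Real.pi * k.factorial := by
    intro k
    have h := Complex.integral_rpow_mul_exp_neg_rpow (p := 2) (q := 2 * k) (by norm_num)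
      (by have : (0 : ℝ) ≤ k := k.cast_nonneg
          linarith)
    have h3 : ((2 * k + 2) / 2 : ℝ) = k + 1 := by ring
    rw [h3, Real.Gamma_nat_eq_factorial] at h
    rw [show 2 * Real.pi / 2 = Real.pi by ring] at h
    rw [← h]
    congr 1
    ext w
    norm_cast
  have hint : ∀ k : ℕ, Integrable fun w : ℂ => ‖w‖ ^ (2 * k) * Real.exp (-‖w‖ ^ 2) := by
    intro k
    refine Integrable.of_integral_ne_zero ?_
    rw [h1]
    positivity
  have heq : ∀ z : Cn n, ‖∏ i, z i ^ α i‖ ^ 2 * fWt z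
      = ∏ i, (‖z i‖ ^ (2 * α i) * Real.exp (-‖z i‖ ^ 2)) := by
    intro z
    rw [Finset.prod_mul_distrib, ← Real.exp_sum, fWt, Finset.sum_neg_distrib, norm_prod,
      ← Finset.prod_pow]
    congr 1
    refine Finset.prod_congr rfl fun i _ => ?_
    rw [norm_pow, ← pow_mul, mul_comm]
  simp only [heq]
  have hprod : Integrable fun z : Cn n => ∏ i, (‖z i‖ ^ (2 * α i) * Real.exp (-‖z i‖ ^ 2)) :=
    Integrable.fintype_prod fun i => hint (α i)
  rw [← ofReal_integral_eq_lintegral_ofReal hprod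
    (Eventually.of_forall fun z => Finset.prod_nonneg fun i _ => by positivity)]
  rw [integral_fintype_prod_volume_eq_prod
    (fun i (w : ℂ) => ‖w‖ ^ (2 * α i) * Real.exp (-‖w‖ ^ 2))]
  simp only [h1, monoWt]

/-- Parseval's identity in the Fock space, in `[0, ∞]`. -/
lemma HasCoeff.lintegral_eq {f : Cn n → ℂ} {c : (Fin n → ℕ) → ℂ} (h : HasCoeff f c)
    (hf : Continuous f) : ∫⁻ z : Cn n, ENNReal.ofReal (‖f z‖ ^ 2 * fWt z)
      = ∑' α, ENNReal.ofReal (monoWt α * ‖c α‖ ^ 2) := by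
  have hw := continuous_fWt (n := n)
  have hr := continuous_torusRot (n := n)
  have hrot : ∀ t : UnitAddTorus (Fin n),
      ∫⁻ z : Cn n, ENNReal.ofReal (‖f (torusRot t z)‖ ^ 2 * fWt z)
        = ∫⁻ z : Cn n, ENNReal.ofReal (‖f z‖ ^ 2 * fWt z) := by
    intro t
    rw [← (measurePreserving_torusRot t).lintegral_comp
      (f := fun z => ENNReal.ofReal (‖f z‖ ^ 2 * fWt z))
      (Continuous.measurable (by fun_prop)).ennreal_ofReal]
    simp only [fWt_torusRot]
  have hinner : ∀ z : Cn n,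
      ∫⁻ t : UnitAddTorus (Fin n), ENNReal.ofReal (‖f (torusRot t z)‖ ^ 2 * fWt z)
        = ∑' α : Fin n → ℕ, ENNReal.ofReal (‖c α * ∏ i, z i ^ α i‖ ^ 2 * fWt z) := by
    intro z
    obtain ⟨hs, hc⟩ := h.hasSum_torus z
    rw [← ofReal_integral_eq_lintegral_ofReal
      (Continuous.integrable_of_hasCompactSupport (by fun_prop)
        (HasCompactSupport.of_compactSpace _))
      (Eventually.of_forall fun t => mul_nonneg (by positivity) (fWt_nonneg z)),
      integral_mul_const, ← (hs.mul_right (fWt z)).tsum_eq,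
      ENNReal.ofReal_tsum_of_nonneg (fun α => mul_nonneg (by positivity) (fWt_nonneg z))
        (hs.mul_right (fWt z)).summable]
  calc ∫⁻ z : Cn n, ENNReal.ofReal (‖f z‖ ^ 2 * fWt z)
      = ∫⁻ t : UnitAddTorus (Fin n), ∫⁻ z : Cn n,
          ENNReal.ofReal (‖f (torusRot t z)‖ ^ 2 * fWt z) := by
        simp only [hrot, lintegral_const, measure_univ, mul_one]
    _ = ∫⁻ z : Cn n, ∫⁻ t : UnitAddTorus (Fin n),
          ENNReal.ofReal (‖f (torusRot t z)‖ ^ 2 * fWt z) := by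
        apply lintegral_lintegral_swap
        exact ((Continuous.measurable (by fun_prop)).ennreal_ofReal).aemeasurable
    _ = ∑' α : Fin n → ℕ, ∫⁻ z : Cn n,
          ENNReal.ofReal (‖c α * ∏ i, z i ^ α i‖ ^ 2 * fWt z) := by
        simp only [hinner]
        exact lintegral_tsum fun α =>
          (Continuous.measurable (by fun_prop)).ennreal_ofReal.aemeasurable
    _ = ∑' α, ENNReal.ofReal (monoWt α * ‖c α‖ ^ 2) := by
        refine tsum_congr fun α => ?_
        rw [mul_comm, ENNReal.ofReal_mul (by positivity), ← lintegral_mono_sq,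
          ← lintegral_const_mul _ (Continuous.measurable (by fun_prop)).ennreal_ofReal]
        congr 1
        ext z
        rw [← ENNReal.ofReal_mul (by positivity), norm_mul, mul_pow, mul_assoc]

end Torus

section Coefficients

variable {n : ℕ} {f g : Cn n → ℂ} {c d : (Fin n → ℕ) → ℂ}

lemma HasCoeff.add (hf : HasCoeff f c) (hg : HasCoeff g d) :
    HasCoeff (fun z => f z + g z) (fun α => c α + d α) := fun z => by
  simpa only [add_mul] using (hf z).add (hg z)

lemma HasCoeff.const_mul (a : ℂ) (hf : HasCoeff f c) :
    HasCoeff (fun z => a * f z) (fun α => a * c α) := fun z => by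
  simpa only [mul_assoc] using (hf z).mul_left a

lemma HasCoeff.sum {ι : Type*} {s : Finset ι} {f : ι → Cn n → ℂ} {c : ι → (Fin n → ℕ) → ℂ}
    (h : ∀ i ∈ s, HasCoeff (f i) (c i)) :
    HasCoeff (fun z => ∑ i ∈ s, f i z) (fun α => ∑ i ∈ s, c i α) := fun z => by
  simpa only [Finset.sum_mul] using hasSum_sum fun i hi => h i hi z

lemma hasCoeff_zero : HasCoeff (0 : Cn n → ℂ) 0 := fun z => by
  simp

lemma hasCoeff_monomial (β : Fin n → ℕ) :
    HasCoeff (fun z : Cn n => ∏ i, z i ^ β i) (Pi.single β 1) := fun z => by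
  have h := hasSum_single (f := fun α : Fin n → ℕ =>
    (Pi.single β (1 : ℂ) : (Fin n → ℕ) → ℂ) α * ∏ i, z i ^ α i) β (fun α hα => by
      rw [Pi.single_eq_of_ne hα, zero_mul])
  simpa only [Pi.single_eq_same, one_mul] using h

lemma injective_add_single (j : Fin n) :
    Function.Injective fun α : Fin n → ℕ => α + Pi.single j 1 :=
  add_left_injective _

lemma mem_range_add_single {j : Fin n} {α : Fin n → ℕ} (h : α j ≠ 0) :
    α - Pi.single j 1 + Pi.single j 1 = α := by
  ext i
  by_cases hi : i = j
  · subst hi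
    simp
    omega
  · simp [Pi.single_eq_of_ne hi]

lemma prod_pow_add_single (α : Fin n → ℕ) (j : Fin n) (z : Cn n) :
    ∏ i, z i ^ (α + Pi.single j 1 : Fin n → ℕ) i = z j * ∏ i, z i ^ α i := by
  simp only [Pi.add_apply, pow_add, Finset.prod_mul_distrib]
  rw [mul_comm]
  congr 1
  rw [Finset.prod_eq_single j]
  · simp
  · intro i _ hi
    simp [Pi.single_eq_of_ne hi]
  · simp

/-- Multiplication by `z_j` shifts the coefficients up. -/
lemma HasCoeff.coord_mul (hf : HasCoeff f c) (j : Fin n) :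
    HasCoeff (fun z => z j * f z)
      (fun α => if α j = 0 then 0 else c (α - Pi.single j 1)) := fun z => by
  refine ((injective_add_single j).hasSum_iff fun α hα => ?_).mp ?_
  · have : α j = 0 := by
      by_contra h
      exact hα ⟨_, mem_range_add_single h⟩
    simp [this]
  · have e : ((fun α : Fin n → ℕ => (if α j = 0 then 0 else c (α - Pi.single j 1)) *
        ∏ i, z i ^ α i) ∘ fun α : Fin n → ℕ => α + Pi.single j 1)
        = fun α => z j * (c α * ∏ i, z i ^ α i) := by
      ext α
      simp only [Function.comp_apply, prod_pow_add_single, add_tsub_cancel_right]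
      rw [if_neg (by simp)]
      ring
    rw [e]
    exact (hf z).mul_left _

/-- The Fréchet derivative of a monomial. -/
def monoDeriv (α : Fin n → ℕ) (z : Cn n) : Cn n →L[ℂ] ℂ :=
  ∑ j, ((α j : ℂ) * ∏ i, z i ^ (α - Pi.single j 1 : Fin n → ℕ) i) •
    ContinuousLinearMap.proj (R := ℂ) (φ := fun _ : Fin n => ℂ) j

lemma hasFDerivAt_monomial (α : Fin n → ℕ) (z : Cn n) :
    HasFDerivAt (fun z : Cn n => ∏ i, z i ^ α i) (monoDeriv α z) z := by
  have h := HasFDerivAt.finsetProd (u := Finset.univ) (x := z)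
    (g := fun (i : Fin n) (z : Cn n) => z i ^ α i) fun i _ =>
      ((ContinuousLinearMap.proj (R := ℂ) (φ := fun _ : Fin n => ℂ) i).hasFDerivAt
        (x := z)).pow (α i)
  refine h.congr_fderiv ?_
  refine Finset.sum_congr rfl fun j _ => ?_
  rw [smul_smul]
  congr 1
  rw [← Finset.mul_prod_erase Finset.univ _ (Finset.mem_univ j)]
  have : ∀ i ∈ Finset.univ.erase j, z i ^ (α - Pi.single j 1 : Fin n → ℕ) i = z i ^ α i := by
    intro i hi
    simp [Pi.single_eq_of_ne (Finset.ne_of_mem_erase hi)]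
  rw [Finset.prod_congr rfl this]
  simp
  ring

lemma norm_monoDeriv_le (α : Fin n → ℕ) {z : Cn n} {R : ℝ} (hR : 1 ≤ R) (hz : ‖z‖ ≤ R) :
    ‖monoDeriv α z‖ ≤ ∏ i, (2 * R) ^ α i := by
  have hterm : ∀ j, ‖((α j : ℂ) * ∏ i, z i ^ (α - Pi.single j 1 : Fin n → ℕ) i) •
      ContinuousLinearMap.proj (R := ℂ) (φ := fun _ : Fin n => ℂ) j‖
        ≤ α j * ∏ i, R ^ α i := by
    intro j
    have hproj : ‖ContinuousLinearMap.proj (R := ℂ) (φ := fun _ : Fin n => ℂ) j‖ ≤ 1 :=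
      ContinuousLinearMap.opNorm_le_bound _ zero_le_one fun x => by
        simpa using norm_le_pi_norm x j
    rw [norm_smul, norm_mul, Complex.norm_natCast, norm_prod]
    refine (mul_le_of_le_one_right (by positivity) hproj).trans ?_
    refine mul_le_mul_of_nonneg_left ?_ (by positivity)
    refine Finset.prod_le_prod (fun i _ => norm_nonneg _) fun i _ => ?_
    rw [norm_pow]
    calc ‖z i‖ ^ (α - Pi.single j 1 : Fin n → ℕ) i
        ≤ R ^ (α - Pi.single j 1 : Fin n → ℕ) i :=
          pow_le_pow_left₀ (norm_nonneg _) ((norm_le_pi_norm z i).trans hz) _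
      _ ≤ R ^ α i := pow_le_pow_right₀ hR (by simp)
  calc ‖monoDeriv α z‖ ≤ ∑ j, (α j : ℝ) * ∏ i, R ^ α i :=
        (norm_sum_le _ _).trans (Finset.sum_le_sum fun j _ => hterm j)
    _ = ((∑ j, α j : ℕ) : ℝ) * ∏ i, R ^ α i := by
        rw [← Finset.sum_mul]
        push_cast
        rfl
    _ ≤ (2 : ℝ) ^ (∑ j, α j) * ∏ i, R ^ α i := by
        refine mul_le_mul_of_nonneg_right ?_ (by positivity)
        exact_mod_cast (Nat.lt_two_pow_self (n := ∑ j, α j)).le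
    _ = ∏ i, (2 * R) ^ α i := by
        simp only [mul_pow, Finset.prod_mul_distrib, Finset.prod_pow_eq_pow_sum]

lemma HasCoeff.hasFDerivAt (hf : HasCoeff f c) (z : Cn n) :
    (Summable fun α => c α • monoDeriv α z) ∧ HasFDerivAt f (∑' α, c α • monoDeriv α z) z := by
  set R : ℝ := ‖z‖ + 1 with hRdef
  have hR : 1 ≤ R := by simp [hRdef]
  have hu : Summable fun α : Fin n → ℕ => ‖c α‖ * ∏ i, (2 * R) ^ α i := by
    have h := (hf fun _ => ((2 * R : ℝ) : ℂ)).summable.norm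
    simpa [norm_mul, norm_prod, abs_of_nonneg (zero_le_one.trans hR)] using h
  have hbd : ∀ α, ∀ x ∈ Metric.ball (0 : Cn n) R,
      ‖c α • monoDeriv α x‖ ≤ ‖c α‖ * ∏ i, (2 * R) ^ α i := by
    intro α x hx
    rw [norm_smul]
    exact mul_le_mul_of_nonneg_left
      (norm_monoDeriv_le α hR (mem_ball_zero_iff.mp hx).le) (norm_nonneg _)
  have hz : z ∈ Metric.ball (0 : Cn n) R := by simp [hRdef]
  refine ⟨Summable.of_norm_bounded hu fun α => hbd α z hz, ?_⟩
  have h := hasFDerivAt_tsum_of_isPreconnected (𝕜 := ℂ) hu Metric.isOpen_ball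
    (convex_ball (0 : Cn n) R).isPreconnected
    (f := fun α (x : Cn n) => c α * ∏ i, x i ^ α i) (f' := fun α x => c α • monoDeriv α x)
    (fun α x _ => (hasFDerivAt_monomial α x).const_mul (c α)) hbd hz (hf z).summable hz
  have e : (fun x : Cn n => ∑' α : Fin n → ℕ, c α * ∏ i, x i ^ α i) = f :=
    funext fun x => (hf x).tsum_eq
  rwa [e] at h

lemma HasCoeff.differentiable (hf : HasCoeff f c) : Differentiable ℂ f :=
  fun z => (hf.hasFDerivAt z).2.differentiableAt

/-- Differentiation in `z_j` shifts the coefficients down. -/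
lemma HasCoeff.pdz (hf : HasCoeff f c) (j : Fin n) :
    HasCoeff (pdz j f) (fun α => ((α j + 1 : ℕ) : ℂ) * c (α + Pi.single j 1)) := fun z => by
  obtain ⟨hs, hd⟩ := hf.hasFDerivAt z
  have h := hs.hasSum.mapL (ContinuousLinearMap.apply ℂ ℂ (Pi.single j (1 : ℂ) : Cn n))
  simp only [ContinuousLinearMap.apply_apply] at h
  have hval : ∀ α : Fin n → ℕ, (c α • monoDeriv α z) (Pi.single j (1 : ℂ) : Cn n)
      = c α * ((α j : ℂ) * ∏ i, z i ^ (α - Pi.single j 1 : Fin n → ℕ) i) := by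
    intro α
    simp only [monoDeriv, smul_apply, _root_.sum_apply,
      ContinuousLinearMap.proj_apply, smul_eq_mul]
    congr 1
    rw [Finset.sum_eq_single j]
    · simp
    · intro i _ hi
      simp [Pi.single_eq_of_ne hi]
    · simp
  simp only [hval] at h
  rw [← hd.fderiv] at h
  have h' := ((injective_add_single j).hasSum_iff fun α hα => ?_).mpr h
  · have e : ((fun α : Fin n → ℕ => c α * ((α j : ℂ) *
        ∏ i, z i ^ (α - Pi.single j 1 : Fin n → ℕ) i)) ∘ fun α : Fin n → ℕ => α + Pi.single j 1)
        = fun α => ((α j + 1 : ℕ) : ℂ) * c (α + Pi.single j 1) * ∏ i, z i ^ α i := by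
      ext α
      simp only [Function.comp_apply, add_tsub_cancel_right, Pi.add_apply, Pi.single_eq_same]
      ring
    rwa [e] at h'
  · have : α j = 0 := by
      by_contra h
      exact hα ⟨_, mem_range_add_single h⟩
    simp [this]

lemma HasCoeff.eq_zero (hf : HasCoeff (0 : Cn n → ℂ) c) : c = 0 := by
  have h := hf.lintegral_eq continuous_zero
  simp only [Pi.zero_apply, norm_zero, ne_eq, OfNat.ofNat_ne_zero, not_false_eq_true, zero_pow,
    zero_mul, ENNReal.ofReal_zero, lintegral_zero] at h
  ext α
  have h1 := ENNReal.ofReal_eq_zero.mp (ENNReal.tsum_eq_zero.mp h.symm α)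
  have h2 := monoWt_pos α
  have h3 : ‖c α‖ ^ 2 ≤ 0 := by
    by_contra! h4
    exact absurd h1 (not_le.mpr (mul_pos h2 h4))
  simpa using le_antisymm h3 (by positivity)

lemma HasCoeff.unique (hf : HasCoeff f c) (hg : HasCoeff f d) : c = d := by
  have h := hf.add (hg.const_mul (-1))
  have e : (fun z => f z + -1 * f z) = (0 : Cn n → ℂ) := by
    ext z
    simp
  rw [e] at h
  ext α
  have := congrFun h.eq_zero α
  simp only [Pi.zero_apply] at this
  linear_combination this

lemma HasCoeff.eq (hf : HasCoeff f c) (hg : HasCoeff g c) : f = g :=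
  funext fun z => (hf z).unique (hg z)

lemma HasCoeff.memF_iff (hf : HasCoeff f c) :
    MemF f ↔ Summable fun α => monoWt α * ‖c α‖ ^ 2 := by
  have hc := hf.differentiable.continuous
  have hnn : ∀ z, 0 ≤ ‖f z‖ ^ 2 * fWt z := fun z => mul_nonneg (by positivity) (fWt_nonneg z)
  have hnn' : ∀ α, 0 ≤ monoWt α * ‖c α‖ ^ 2 := fun α =>
    mul_nonneg (monoWt_pos α).le (by positivity)
  have hmeas : AEStronglyMeasurable fun z => ‖f z‖ ^ 2 * fWt z :=
    Continuous.aestronglyMeasurable (by have := continuous_fWt (n := n); fun_prop)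
  rw [MemF, and_iff_right hf.differentiable,
    ← lintegral_ofReal_ne_top_iff_integrable hmeas (Eventually.of_forall hnn),
    hf.lintegral_eq hc]
  constructor
  · intro h
    have := ENNReal.summable_toReal h
    simpa only [ENNReal.toReal_ofReal (hnn' _)] using this
  · intro h
    exact h.tsum_ofReal_ne_top

lemma HasCoeff.fNormSq_eq (hf : HasCoeff f c) :
    fNormSq f = ∑' α, monoWt α * ‖c α‖ ^ 2 := by
  have hc := hf.differentiable.continuous
  rw [fNormSq, integral_eq_lintegral_of_nonneg_ae
    (Eventually.of_forall fun z => mul_nonneg (by positivity) (fWt_nonneg z))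
    (Continuous.aestronglyMeasurable (by have := continuous_fWt (n := n); fun_prop)),
    hf.lintegral_eq hc, ENNReal.tsum_toReal_eq fun α => ENNReal.ofReal_ne_top]
  exact tsum_congr fun α =>
    ENNReal.toReal_ofReal (mul_nonneg (monoWt_pos α).le (by positivity))

end Coefficients

section Sobolev

variable {n : ℕ} {f g : Cn n → ℂ} {c : (Fin n → ℕ) → ℂ}

/-- Entire functions whose coefficients are square summable with the weight
`(|α| + 1)^s ‖z^α‖²`; for `s = 0` this is the Fock space. -/
def MemFockSobolev (s : ℕ) (f : Cn n → ℂ) : Prop :=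
  ∃ c, HasCoeff f c ∧
    Summable fun α : Fin n → ℕ => ((∑ i, α i : ℕ) + 1 : ℝ) ^ s * (monoWt α * ‖c α‖ ^ 2)

lemma MemFockSobolev.memF {s : ℕ} (h : MemFockSobolev s f) : MemF f := by
  obtain ⟨c, hc, hs⟩ := h
  rw [hc.memF_iff]
  refine Summable.of_nonneg_of_le (fun α => mul_nonneg (monoWt_pos α).le (by positivity))
    (fun α => ?_) hs
  refine le_mul_of_one_le_left (mul_nonneg (monoWt_pos α).le (by positivity)) ?_
  exact one_le_pow₀ (le_add_of_nonneg_left (Nat.cast_nonneg _))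

lemma MemFockSobolev.add {s : ℕ} (hf : MemFockSobolev s f) (hg : MemFockSobolev s g) :
    MemFockSobolev s (fun z => f z + g z) := by
  obtain ⟨c, hc, hcs⟩ := hf
  obtain ⟨d, hd, hds⟩ := hg
  refine ⟨_, hc.add hd, Summable.of_nonneg_of_le (fun α => ?_) (fun α => ?_)
    ((hcs.add hds).mul_left 2)⟩
  · have := monoWt_pos α
    positivity
  · have hw := monoWt_pos α
    have h1 : ‖c α + d α‖ ^ 2 ≤ 2 * (‖c α‖ ^ 2 + ‖d α‖ ^ 2) := by
      have h2 := norm_add_le (c α) (d α)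
      nlinarith [norm_nonneg (c α + d α), sq_nonneg (‖c α‖ - ‖d α‖)]
    calc ((∑ i, α i : ℕ) + 1 : ℝ) ^ s * (monoWt α * ‖c α + d α‖ ^ 2)
        ≤ ((∑ i, α i : ℕ) + 1 : ℝ) ^ s * (monoWt α * (2 * (‖c α‖ ^ 2 + ‖d α‖ ^ 2))) := by
          gcongr
      _ = _ := by ring

lemma MemFockSobolev.const_mul {s : ℕ} (a : ℂ) (hf : MemFockSobolev s f) :
    MemFockSobolev s (fun z => a * f z) := by
  obtain ⟨c, hc, hcs⟩ := hf
  refine ⟨_, hc.const_mul a, (hcs.mul_left (‖a‖ ^ 2)).congr fun α => ?_⟩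
  rw [norm_mul]
  ring

lemma memFockSobolev_zero (s : ℕ) : MemFockSobolev s (0 : Cn n → ℂ) :=
  ⟨0, hasCoeff_zero, by simp⟩

lemma memFockSobolev_monomial (s : ℕ) (β : Fin n → ℕ) :
    MemFockSobolev s (fun z : Cn n => ∏ i, z i ^ β i) :=
  ⟨_, hasCoeff_monomial β, summable_of_ne_finset_zero (s := {β}) fun α hα => by
    rw [Pi.single_eq_of_ne (by simpa using hα)]
    simp⟩

lemma MemFockSobolev.sum {ι : Type*} {s : ℕ} {t : Finset ι} {f : ι → Cn n → ℂ}
    (h : ∀ i ∈ t, MemFockSobolev s (f i)) : MemFockSobolev s (fun z => ∑ i ∈ t, f i z) := by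
  classical
  induction t using Finset.induction_on with
  | empty =>
    simp only [Finset.sum_empty]
    exact memFockSobolev_zero s
  | insert i t hi ih =>
    simp only [Finset.sum_insert hi]
    exact (h i (Finset.mem_insert_self i t)).add
      (ih fun k hk => h k (Finset.mem_insert_of_mem hk))

lemma monoWt_add_single (α : Fin n → ℕ) (j : Fin n) :
    monoWt (α + Pi.single j 1) = (α j + 1) * monoWt α := by
  unfold monoWt
  rw [← Finset.mul_prod_erase Finset.univ _ (Finset.mem_univ j),
    ← Finset.mul_prod_erase Finset.univ (fun i => Real.pi * ((α i).factorial : ℝ))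
      (Finset.mem_univ j)]
  have : ∀ i ∈ Finset.univ.erase j,
      Real.pi * (((α + Pi.single j 1 : Fin n → ℕ) i).factorial : ℝ)
        = Real.pi * ((α i).factorial : ℝ) := by
    intro i hi
    simp [Pi.single_eq_of_ne (Finset.ne_of_mem_erase hi)]
  rw [Finset.prod_congr rfl this]
  simp only [Pi.add_apply, Pi.single_eq_same, Nat.factorial_succ]
  push_cast
  ring

lemma sum_add_single (α : Fin n → ℕ) (j : Fin n) :
    ∑ i, (α + Pi.single j 1 : Fin n → ℕ) i = (∑ i, α i) + 1 := by
  simp [Finset.sum_add_distrib]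

lemma apply_le_sum (α : Fin n → ℕ) (j : Fin n) : α j ≤ ∑ i, α i :=
  Finset.single_le_sum (fun _ _ => Nat.zero_le _) (Finset.mem_univ j)

lemma MemFockSobolev.pdz {s : ℕ} (hf : MemFockSobolev (s + 1) f) (j : Fin n) :
    MemFockSobolev s (pdz j f) := by
  obtain ⟨c, hc, hcs⟩ := hf
  refine ⟨_, hc.pdz j, Summable.of_nonneg_of_le (fun α => ?_) (fun α => ?_)
    (hcs.comp_injective (injective_add_single j))⟩
  · have := monoWt_pos α
    positivity
  · have hw := monoWt_pos α
    simp only [Function.comp_apply, sum_add_single, monoWt_add_single, norm_mul,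
      Complex.norm_natCast]
    have h1 : ((α j : ℕ) : ℝ) ≤ (∑ i, α i : ℕ) := by exact_mod_cast apply_le_sum α j
    have hA : (0 : ℝ) ≤ α j := by positivity
    push_cast at h1 ⊢
    set A : ℝ := ∑ i, (α i : ℝ)
    calc (A + 1) ^ s * (monoWt α * (((α j : ℝ) + 1) * ‖c (α + Pi.single j 1)‖) ^ 2)
        = ((A + 1) ^ s * (α j + 1)) *
            ((α j + 1) * monoWt α * ‖c (α + Pi.single j 1)‖ ^ 2) := by ring
      _ ≤ ((A + 1 + 1) ^ s * (A + 1 + 1)) *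
            ((α j + 1) * monoWt α * ‖c (α + Pi.single j 1)‖ ^ 2) := by
          have hA' : 0 ≤ A := hA.trans h1
          gcongr
          · linarith
          · linarith
      _ = _ := by ring

lemma MemFockSobolev.coord_mul {s : ℕ} (hf : MemFockSobolev (s + 1) f) (j : Fin n) :
    MemFockSobolev s (fun z => z j * f z) := by
  obtain ⟨c, hc, hcs⟩ := hf
  refine ⟨_, hc.coord_mul j, ((injective_add_single j).summable_iff fun α hα => ?_).mp ?_⟩
  · have : α j = 0 := by
      by_contra h
      exact hα ⟨_, mem_range_add_single h⟩
    simp [this]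
  · refine Summable.of_nonneg_of_le (fun α => ?_) (fun α => ?_) (hcs.mul_left (2 ^ s))
    · have := monoWt_pos (α + Pi.single j 1)
      simp only [Function.comp_apply]
      positivity
    · have hw := monoWt_pos α
      simp only [Function.comp_apply, sum_add_single, monoWt_add_single, add_tsub_cancel_right]
      rw [if_neg (by simp)]
      have h1 : ((α j : ℕ) : ℝ) ≤ (∑ i, α i : ℕ) := by exact_mod_cast apply_le_sum α j
      push_cast at h1 ⊢
      set A : ℝ := ∑ i, (α i : ℝ)
      have hA : 0 ≤ A := (Nat.cast_nonneg _).trans h1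
      calc (A + 1 + 1) ^ s * ((α j + 1) * monoWt α * ‖c α‖ ^ 2)
          ≤ (2 * (A + 1)) ^ s * ((A + 1) * monoWt α * ‖c α‖ ^ 2) := by
            gcongr
            linarith
        _ = _ := by rw [mul_pow]; ring

end Sobolev

section Box

variable {n : ℕ} {u : FormC n}

lemma memFockSobolev_dOp {s : ℕ} (hu : ∀ J, MemFockSobolev (s + 1) (u J)) (J : Finset (Fin n)) :
    MemFockSobolev s (dOp u J) :=
  MemFockSobolev.sum fun j _ => ((hu (J.erase j)).pdz j).const_mul _

lemma memFockSobolev_dStarOp {s : ℕ} (hu : ∀ J, MemFockSobolev (s + 1) (u J))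
    (J : Finset (Fin n)) : MemFockSobolev s (dStarOp u J) :=
  MemFockSobolev.sum fun j _ => ((hu (insert j J)).coord_mul j).const_mul _

lemma domBox_of_memFockSobolev (hu : ∀ J, MemFockSobolev 2 (u J)) : domBox u :=
  have h1 : MemA2 u := fun J => (hu J).memF
  have h2 : MemA2 (dOp u) := fun J => (memFockSobolev_dOp hu J).memF
  have h3 : MemA2 (dStarOp u) := fun J => (memFockSobolev_dStarOp hu J).memF
  ⟨⟨h1, h2⟩, ⟨h1, h3⟩,
    ⟨h2, fun J => (memFockSobolev_dStarOp (memFockSobolev_dOp hu) J).memF⟩,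
    ⟨h3, fun J => (memFockSobolev_dOp (memFockSobolev_dStarOp hu) J).memF⟩⟩

lemma sgn_mul_self (j : Fin n) (J : Finset (Fin n)) : sgn j J * sgn j J = 1 := by
  rw [sgn, ← mul_pow]
  simp

lemma sgn_insert {j a : Fin n} {K : Finset (Fin n)} (ha : a ∉ K) :
    sgn j (insert a K) = (if a < j then -1 else 1) * sgn j K := by
  unfold sgn
  rw [Finset.filter_insert]
  split_ifs
  · rw [Finset.card_insert_of_notMem (by simp [ha]), pow_succ, mul_comm]
  · rw [one_mul]

lemma sgn_mul_sgn_anticomm {j k : Fin n} {J : Finset (Fin n)} (hj : j ∉ J) (hk : k ∈ J) :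
    sgn j J * sgn k (insert j (J.erase k)) = -(sgn k (J.erase k) * sgn j (J.erase k)) := by
  have h1 : sgn j J = (if k < j then -1 else 1) * sgn j (J.erase k) := by
    conv_lhs => rw [← Finset.insert_erase hk]
    exact sgn_insert (Finset.notMem_erase k J)
  have h2 := sgn_insert (j := k) (a := j) (K := J.erase k) (by simp [hj])
  have hne : j ≠ k := fun h => hj (h ▸ hk)
  rw [h1, h2]
  rcases lt_or_gt_of_ne hne with h | h
  · rw [if_neg (not_lt.mpr h.le), if_pos h]
    ring
  · rw [if_pos h, if_neg (not_lt.mpr h.le)]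
    ring

lemma pdz_coord_mul {f : Cn n → ℂ} (hf : Differentiable ℂ f) (j k : Fin n) (z : Cn n) :
    pdz k (fun z => z j * f z) z = (if j = k then f z else 0) + z j * pdz k f z := by
  have h := (((ContinuousLinearMap.proj (R := ℂ) (φ := fun _ : Fin n => ℂ) j).hasFDerivAt
    (x := z)).mul (hf z).hasFDerivAt).fderiv
  change fderiv ℂ (fun z => z j * f z) z = _ at h
  simp only [pdz, h]
  by_cases hjk : j = k
  · subst hjk
    simp
    ring
  · simp [hjk]

lemma pdz_dStarOp (hu : ∀ J, Differentiable ℂ (u J)) (k : Fin n) (K : Finset (Fin n)) (z : Cn n) :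
    pdz k (dStarOp u K) z = ∑ j ∈ Kᶜ, sgn j K *
      ((if j = k then u (insert j K) z else 0) + z j * pdz k (u (insert j K)) z) := by
  have hd : ∀ j, DifferentiableAt ℂ (fun z : Cn n => z j * u (insert j K) z) z := fun j => by
    have := hu (insert j K)
    fun_prop
  have h : fderiv ℂ (dStarOp u K) z
      = ∑ j ∈ Kᶜ, sgn j K • fderiv ℂ (fun z : Cn n => z j * u (insert j K) z) z := by
    have := HasFDerivAt.fun_sum (u := Kᶜ) fun j _ => ((hd j).hasFDerivAt.const_mul (sgn j K))
    exact this.fderiv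
  simp only [pdz, h, _root_.sum_apply, smul_apply, smul_eq_mul]
  refine Finset.sum_congr rfl fun j _ => ?_
  congr 1
  exact pdz_coord_mul (hu _) j k z

/-- The complex Laplacian acts diagonally: it is the Euler operator plus the degree. -/
lemma boxOp_apply (hu : ∀ J, Differentiable ℂ (u J)) (J : Finset (Fin n)) (z : Cn n) :
    boxOp u J z = ∑ k, z k * pdz k (u J) z + (J.card : ℂ) * u J z := by
  have h1 : dStarOp (dOp u) J z = ∑ j ∈ Jᶜ, z j * pdz j (u J) z +
      ∑ j ∈ Jᶜ, ∑ k ∈ J, sgn j J * sgn k (insert j (J.erase k)) *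
        (z j * pdz k (u (insert j (J.erase k))) z) := by
    rw [← Finset.sum_add_distrib]
    refine Finset.sum_congr rfl fun j hj => ?_
    have hj' : j ∉ J := Finset.mem_compl.mp hj
    rw [dOp, Finset.sum_insert hj', Finset.erase_insert hj', mul_add, mul_add]
    congr 1
    · linear_combination (z j * _root_.pdz j (u J) z) * sgn_mul_self j J
    · rw [Finset.mul_sum, Finset.mul_sum]
      refine Finset.sum_congr rfl fun k hk => ?_
      rw [Finset.erase_insert_of_ne (ne_of_mem_of_not_mem hk hj').symm]
      ring
  have h2 : dOp (dStarOp u) J z = ∑ k ∈ J, (u J z + z k * pdz k (u J) z) +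
      ∑ k ∈ J, ∑ j ∈ Jᶜ, sgn k (J.erase k) * sgn j (J.erase k) *
        (z j * pdz k (u (insert j (J.erase k))) z) := by
    rw [← Finset.sum_add_distrib]
    refine Finset.sum_congr rfl fun k hk => ?_
    rw [pdz_dStarOp hu, Finset.compl_erase, Finset.sum_insert (by simp [hk]),
      Finset.insert_erase hk, if_pos rfl, mul_add]
    congr 1
    · linear_combination (u J z + z k * _root_.pdz k (u J) z) * sgn_mul_self k (J.erase k)
    · rw [Finset.mul_sum]
      refine Finset.sum_congr rfl fun j hj => ?_
      have hj' : j ∉ J := Finset.mem_compl.mp hj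
      rw [if_neg (ne_of_mem_of_not_mem hk hj').symm]
      ring
  have h3 : ∑ j ∈ Jᶜ, ∑ k ∈ J, sgn j J * sgn k (insert j (J.erase k)) *
        (z j * pdz k (u (insert j (J.erase k))) z)
      = -∑ k ∈ J, ∑ j ∈ Jᶜ, sgn k (J.erase k) * sgn j (J.erase k) *
        (z j * pdz k (u (insert j (J.erase k))) z) := by
    rw [Finset.sum_comm, ← Finset.sum_neg_distrib]
    refine Finset.sum_congr rfl fun k hk => ?_
    rw [← Finset.sum_neg_distrib]
    refine Finset.sum_congr rfl fun j hj => ?_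
    rw [sgn_mul_sgn_anticomm (Finset.mem_compl.mp hj) hk]
    ring
  rw [boxOp, h1, h2, h3, Finset.sum_add_distrib, Finset.sum_const, nsmul_eq_mul,
    ← Finset.sum_compl_add_sum J]
  ring

lemma HasCoeff.euler {f : Cn n → ℂ} {c : (Fin n → ℕ) → ℂ} (hf : HasCoeff f c) :
    HasCoeff (fun z => ∑ k, z k * _root_.pdz k f z) (fun α => ((∑ i, α i : ℕ) : ℂ) * c α) := by
  have h := HasCoeff.sum (s := Finset.univ) fun k _ => (hf.pdz k).coord_mul k
  convert h using 1
  ext α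
  push_cast
  rw [Finset.sum_mul]
  refine Finset.sum_congr rfl fun k _ => ?_
  split_ifs with hk
  · simp [hk]
  · rw [mem_range_add_single hk]
    congr 1
    simp only [Pi.sub_apply, Pi.single_eq_same]
    exact_mod_cast (Nat.sub_add_cancel (Nat.one_le_iff_ne_zero.mpr hk)).symm

lemma hasCoeff_boxOp {c : Finset (Fin n) → (Fin n → ℕ) → ℂ} (hu : ∀ J, HasCoeff (u J) (c J))
    (J : Finset (Fin n)) :
    HasCoeff (boxOp u J) (fun α => (((∑ i, α i) + J.card : ℕ) : ℂ) * c J α) := by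
  have e : boxOp u J = fun z => ∑ k, z k * pdz k (u J) z + (J.card : ℂ) * u J z :=
    funext fun z => boxOp_apply (fun J => (hu J).differentiable) J z
  rw [e]
  convert (hu J).euler.add ((hu J).const_mul (J.card : ℂ)) using 1
  ext α
  push_cast
  ring

lemma hasCoeff_monoForm (α : Fin n → ℕ) (J K : Finset (Fin n)) :
    HasCoeff (monoForm α J K) (if K = J then Pi.single α 1 else 0) := by
  unfold monoForm
  by_cases h : K = J
  · simpa only [if_pos h] using hasCoeff_monomial α
  · simp only [if_neg h]
    exact hasCoeff_zero

lemma domBox_monoForm (α : Fin n → ℕ) (J : Finset (Fin n)) : domBox (monoForm α J) := by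
  refine domBox_of_memFockSobolev fun K => ?_
  unfold monoForm
  by_cases h : K = J
  · simpa only [if_pos h] using memFockSobolev_monomial 2 α
  · simp only [if_neg h]
    exact memFockSobolev_zero 2

lemma isDeg_monoForm (α : Fin n → ℕ) (J : Finset (Fin n)) : IsDeg J.card (monoForm α J) := by
  intro K hK
  ext z
  simp only [monoForm, Pi.zero_apply]
  exact if_neg fun h : K = J => hK (h ▸ rfl)

lemma boxOp_monoForm (α : Fin n → ℕ) (J : Finset (Fin n)) :
    boxOp (monoForm α J) = fun K z => (((∑ i, α i) + J.card : ℕ) : ℂ) * monoForm α J K z := by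
  funext K
  refine (hasCoeff_boxOp (hasCoeff_monoForm α J) K).eq ?_
  convert (hasCoeff_monoForm α J K).const_mul _ using 1
  ext β
  by_cases h : K = J
  · subst h
    by_cases hβ : β = α
    · subst hβ
      rfl
    · simp [Pi.single_eq_of_ne hβ]
  · simp [h]

lemma MemA2.exists_hasCoeff (hu : MemA2 u) : ∃ c : Finset (Fin n) → (Fin n → ℕ) → ℂ,
    ∀ J, HasCoeff (u J) (c J) := by
  choose c hc using fun J => (hu J).1.exists_hasCoeff
  exact ⟨c, hc⟩

lemma hasCoeff_boxOp_sub {c : Finset (Fin n) → (Fin n → ℕ) → ℂ} (hu : ∀ J, HasCoeff (u J) (c J))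
    (lam : ℂ) (J : Finset (Fin n)) :
    HasCoeff (fun z => boxOp u J z - lam * u J z)
      (fun α => ((((∑ i, α i) + J.card : ℕ) : ℂ) - lam) * c J α) := by
  convert (hasCoeff_boxOp hu J).add ((hu J).const_mul (-lam)) using 1
  · ext z
    ring
  · ext α
    ring

end Box

section Spectrum

variable {n p : ℕ} {u v : FormC n} {lam : ℂ}

lemma exists_le_mul_norm_sub (h : ∀ m : ℕ, lam ≠ (m : ℂ) + p) :
    ∃ K : ℝ, 0 < K ∧ ∀ m : ℕ, (m + 1 : ℝ) ≤ K * ‖((m + p : ℕ) : ℂ) - lam‖ := by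
  have hpos : ∀ m : ℕ, 0 < ‖((m + p : ℕ) : ℂ) - lam‖ := fun m =>
    norm_pos_iff.mpr (sub_ne_zero.mpr fun e => h m (by rw [← e]; push_cast; rfl))
  obtain ⟨N, hN⟩ := exists_nat_ge (2 * ‖lam‖ + 1)
  have hsum : ∀ m : ℕ, 0 ≤ (m + 1 : ℝ) / ‖((m + p : ℕ) : ℂ) - lam‖ := fun m => by positivity
  refine ⟨2 + ∑ m ∈ Finset.range N, (m + 1 : ℝ) / ‖((m + p : ℕ) : ℂ) - lam‖, ?_, fun m => ?_⟩
  · have := Finset.sum_nonneg fun m (_ : m ∈ Finset.range N) => hsum m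
    linarith
  rw [← div_le_iff₀ (hpos m)]
  by_cases hm : m < N
  · have := Finset.single_le_sum (fun m _ => hsum m) (Finset.mem_range.mpr hm)
    linarith
  · have h1 := Finset.sum_nonneg fun m (_ : m ∈ Finset.range N) => hsum m
    have h2 : (m + 1 : ℝ) / ‖((m + p : ℕ) : ℂ) - lam‖ ≤ 2 := by
      rw [div_le_iff₀ (hpos m)]
      have h3 := norm_sub_norm_le ((m + p : ℕ) : ℂ) lam
      rw [Complex.norm_natCast] at h3
      push_cast at h3 ⊢
      have h4 : (N : ℝ) ≤ m := by exact_mod_cast not_lt.mp hm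
      have h5 : (0 : ℝ) ≤ p := p.cast_nonneg
      linarith
    linarith

lemma HasCoeff.hasCoeff_tsum_of_norm_le {f : Cn n → ℂ} {c d : (Fin n → ℕ) → ℂ}
    (hf : HasCoeff f d) {K : ℝ} (h : ∀ α, ‖c α‖ ≤ K * ‖d α‖) :
    HasCoeff (fun z => ∑' α, c α * ∏ i, z i ^ α i) c := by
  intro z
  refine Summable.hasSum (Summable.of_norm_bounded ((hf z).summable.norm.mul_left K) fun α => ?_)
  rw [norm_mul, norm_mul, ← mul_assoc]
  exact mul_le_mul_of_nonneg_right (h α) (norm_nonneg _)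

lemma formNormSq_le_of_boxOp_sub_eq {K : ℝ}
    (hb : ∀ m : ℕ, (m + 1 : ℝ) ≤ K * ‖((m + p : ℕ) : ℂ) - lam‖)
    (hv : MemA2 v) (hup : IsDeg p u) (hu : MemA2 u)
    (h : (fun J z => boxOp u J z - lam * u J z) = v) :
    formNormSq u ≤ K ^ 2 * formNormSq v := by
  obtain ⟨c, hc⟩ := hu.exists_hasCoeff
  unfold formNormSq
  rw [Finset.mul_sum]
  refine Finset.sum_le_sum fun J _ => ?_
  have hd := hasCoeff_boxOp_sub hc lam J
  have hvJ : (fun z => boxOp u J z - lam * u J z) = v J := congrFun h J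
  rw [hvJ] at hd
  rw [(hc J).fNormSq_eq, hd.fNormSq_eq, ← tsum_mul_left]
  refine Summable.tsum_le_tsum (fun α => ?_) ((hc J).memF_iff.mp (hu J))
    ((hd.memF_iff.mp (hv J)).mul_left _)
  by_cases hJ : J.card = p
  · rw [hJ, norm_mul]
    have h1 : (1 : ℝ) ≤ K * ‖(((∑ i, α i) + p : ℕ) : ℂ) - lam‖ :=
      le_trans (le_add_of_nonneg_left (Nat.cast_nonneg _)) (hb (∑ i, α i))
    have h2 : ‖c J α‖ ≤ K * ‖(((∑ i, α i) + p : ℕ) : ℂ) - lam‖ * ‖c J α‖ :=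
      le_mul_of_one_le_left (norm_nonneg _) h1
    calc monoWt α * ‖c J α‖ ^ 2
        ≤ monoWt α * (K * ‖(((∑ i, α i) + p : ℕ) : ℂ) - lam‖ * ‖c J α‖) ^ 2 :=
          mul_le_mul_of_nonneg_left (pow_le_pow_left₀ (norm_nonneg _) h2 2) (monoWt_pos α).le
      _ = _ := by ring
  · have h0 : c J = 0 := HasCoeff.eq_zero (hup J hJ ▸ hc J)
    simp [h0]

lemma existsUnique_boxOp_sub_eq {K : ℝ}
    (hb : ∀ m : ℕ, (m + 1 : ℝ) ≤ K * ‖((m + p : ℕ) : ℂ) - lam‖)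
    (hvp : IsDeg p v) (hv : MemA2 v) :
    ∃! u : FormC n, IsDeg p u ∧ domBox u ∧ (fun J z => boxOp u J z - lam * u J z) = v := by
  obtain ⟨d, hd⟩ := hv.exists_hasCoeff
  have hd0 : ∀ J : Finset (Fin n), J.card ≠ p → d J = 0 := fun J hJ =>
    HasCoeff.eq_zero (hvp J hJ ▸ hd J)
  have hne : ∀ m : ℕ, ((m + p : ℕ) : ℂ) - lam ≠ 0 := fun m e => by
    have := hb m
    rw [e, norm_zero, mul_zero] at this
    have h0 : (0 : ℝ) ≤ m := m.cast_nonneg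
    linarith
  set c : Finset (Fin n) → (Fin n → ℕ) → ℂ :=
    fun J α => ((((∑ i, α i) + p : ℕ) : ℂ) - lam)⁻¹ * d J α with hcdef
  have hle : ∀ J α, ((∑ i, α i : ℕ) + 1 : ℝ) * ‖c J α‖ ≤ K * ‖d J α‖ := fun J α => by
    have hpos := norm_pos_iff.mpr (hne (∑ i, α i))
    rw [hcdef, norm_mul, norm_inv, ← mul_assoc]
    refine mul_le_mul_of_nonneg_right ?_ (norm_nonneg _)
    rw [← div_eq_mul_inv, div_le_iff₀ hpos]
    exact hb _
  have hc : ∀ J, HasCoeff (fun z => ∑' α, c J α * ∏ i, z i ^ α i) (c J) := fun J =>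
    (hd J).hasCoeff_tsum_of_norm_le (K := K) fun α =>
      le_trans (le_mul_of_one_le_left (norm_nonneg _) (le_add_of_nonneg_left (Nat.cast_nonneg _)))
        (hle J α)
  refine ⟨fun J z => ∑' α, c J α * ∏ i, z i ^ α i, ⟨fun J hJ => ?_, ?_, ?_⟩, ?_⟩
  · ext z
    simp [hcdef, hd0 J hJ]
  · refine domBox_of_memFockSobolev fun J => ⟨c J, hc J, ?_⟩
    refine Summable.of_nonneg_of_le (fun α => ?_) (fun α => ?_)
      (((hd J).memF_iff.mp (hv J)).mul_left (K ^ 2))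
    · have := (monoWt_pos α).le
      positivity
    · calc ((∑ i, α i : ℕ) + 1 : ℝ) ^ 2 * (monoWt α * ‖c J α‖ ^ 2)
          = monoWt α * (((∑ i, α i : ℕ) + 1 : ℝ) * ‖c J α‖) ^ 2 := by ring
        _ ≤ monoWt α * (K * ‖d J α‖) ^ 2 :=
          mul_le_mul_of_nonneg_left (pow_le_pow_left₀ (by positivity) (hle J α) 2)
            (monoWt_pos α).le
        _ = _ := by ring
  · funext J
    refine (hasCoeff_boxOp_sub hc lam J).eq ?_
    have e : (fun α : Fin n → ℕ => ((((∑ i, α i) + J.card : ℕ) : ℂ) - lam) * c J α) = d J := by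
      funext α
      by_cases hJ : J.card = p
      · rw [hJ, hcdef, mul_inv_cancel_left₀ (hne _)]
      · simp [hcdef, hd0 J hJ]
    rw [e]
    exact hd J
  · rintro w ⟨hwp, hw, he⟩
    obtain ⟨a, ha⟩ := hw.1.1.exists_hasCoeff
    funext J
    suffices hac : a J = c J from (hac ▸ ha J).eq (hc J)
    funext α
    by_cases hJ : J.card = p
    · have h1 := hasCoeff_boxOp_sub ha lam J
      rw [congrFun he J] at h1
      have h2 := congrFun (h1.unique (hd J)) α
      simp only [hJ] at h2
      simp only [hcdef, ← h2, inv_mul_cancel_left₀ (hne _)]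
    · have h0 : a J = 0 := HasCoeff.eq_zero (hwp J hJ ▸ ha J)
      simp [h0, hcdef, hd0 J hJ]

lemma monoForm_ne_zero (α : Fin n → ℕ) (J : Finset (Fin n)) : monoForm α J ≠ 0 := by
  intro h
  have := congrFun (congrFun h J) 1
  simp [monoForm] at this

lemma linearIndependent_monoForm :
    LinearIndependent ℂ fun q : (Fin n → ℕ) × Finset (Fin n) => monoForm q.1 q.2 := by
  rw [linearIndependent_iff']
  intro s a h q hq
  have h1 := HasCoeff.sum (s := s) fun r _ => (hasCoeff_monoForm r.1 r.2 q.2).const_mul (a r)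
  have h2 : (fun z => ∑ r ∈ s, a r * monoForm r.1 r.2 q.2 z) = 0 := by
    funext z
    simpa [Finset.sum_apply] using congrFun (congrFun h q.2) z
  rw [h2] at h1
  have h3 := congrFun h1.eq_zero q.1
  simp only [Pi.zero_apply] at h3
  rw [Finset.sum_eq_single_of_mem q hq] at h3
  · simpa using h3
  · rintro ⟨β, L⟩ - hr
    by_cases hL : q.2 = L
    · have hβ : q.1 ≠ β := fun e => hr (Prod.ext e.symm hL.symm)
      simp [hL, Pi.single_eq_of_ne hβ]
    · simp [hL]

/-- The indices of the monomial `(p,0)`-forms of polynomial degree `m`. -/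
def monoFormIndex (n p m : ℕ) : Finset ((Fin n →₀ ℕ) × Finset (Fin n)) :=
  (Finset.univ : Finset (Fin n)).finsuppAntidiag m ×ˢ Finset.powersetCard p Finset.univ

lemma mem_monoFormIndex {m : ℕ} {q : (Fin n →₀ ℕ) × Finset (Fin n)} :
    q ∈ monoFormIndex n p m ↔ ∑ i, q.1 i = m ∧ q.2.card = p := by
  simp [monoFormIndex, Finset.mem_finsuppAntidiag]

lemma card_monoFormIndex (hn : 1 ≤ n) (m : ℕ) :
    (monoFormIndex n p m).card = (n + m - 1).choose (n - 1) * n.choose p := by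
  rw [monoFormIndex, Finset.card_product, Finset.card_finsuppAntidiag_nat_eq_choose,
    Finset.card_powersetCard, Finset.card_univ, Fintype.card_fin]
  congr 1
  exact Nat.choose_symm_of_eq_add (by omega)

lemma eq_sum_monoForm_of_boxOp_eq {m : ℕ} (hup : IsDeg p u) {c : Finset (Fin n) → (Fin n → ℕ) → ℂ}
    (hc : ∀ J, HasCoeff (u J) (c J)) (h : boxOp u = fun K z => ((m + p : ℕ) : ℂ) * u K z) :
    u = ∑ q ∈ monoFormIndex n p m, c q.2 q.1 • monoForm q.1 q.2 := by
  have hzero : ∀ J α, c J α ≠ 0 → ∑ i, α i = m ∧ J.card = p := by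
    intro J α hne
    have hJ : J.card = p := by
      by_contra hJ
      exact hne (congrFun (HasCoeff.eq_zero (hup J hJ ▸ hc J)) α)
    refine ⟨?_, hJ⟩
    have h1 := hasCoeff_boxOp hc J
    rw [congrFun h J] at h1
    have h2 := congrFun (h1.unique ((hc J).const_mul _)) α
    have h3 := mul_right_cancel₀ hne h2
    rw [hJ] at h3
    have h4 : (∑ i, α i) + p = m + p := by exact_mod_cast h3
    omega
  funext J
  have h1 := HasCoeff.sum (s := monoFormIndex n p m) fun q _ =>
    (hasCoeff_monoForm q.1 q.2 J).const_mul (c q.2 q.1)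
  have e : (∑ q ∈ monoFormIndex n p m, c q.2 q.1 • monoForm q.1 q.2) J =
      fun z => ∑ q ∈ monoFormIndex n p m, c q.2 q.1 * monoForm q.1 q.2 J z := by
    funext z
    simp [Finset.sum_apply]
  rw [e]
  refine (hc J).eq ?_
  convert h1 using 1
  funext α
  have hoff : ∀ q : (Fin n →₀ ℕ) × Finset (Fin n), q ≠ (Finsupp.equivFunOnFinite.symm α, J) →
      c q.2 q.1 * (if J = q.2 then Pi.single (⇑q.1) 1 else 0 : (Fin n → ℕ) → ℂ) α = 0 := by
    rintro ⟨β, L⟩ hr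
    by_cases hL : J = L
    · have hβ : α ≠ ⇑β := fun e => hr (Prod.ext (by ext i; simp [e]) hL.symm)
      simp [hL, Pi.single_eq_of_ne hβ]
    · simp [hL]
  rw [Finset.sum_eq_single (Finsupp.equivFunOnFinite.symm α, J) (fun q _ hq => hoff q hq)]
  · simp
  · intro hmem
    have h0 : c J α = 0 := by
      by_contra hne
      exact hmem (mem_monoFormIndex.mpr (by simpa using hzero J α hne))
    simp [h0]

end Spectrum

/-- Spectrum of `□̃_p`, `0 ≤ p ≤ n`: every monomial form `z^α dz_J` with
`|α| = m` is an eigenvector with eigenvalue `m + p`; the spectrum (complement of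
the set of `λ` where `□̃_p − λ` has a bounded everywhere-defined inverse) is
exactly `{m + p : m ∈ ℕ}`; and the eigenspace of `m + p` has dimension
`binom(n+m−1, n−1) · binom(n, p)`. -/
theorem stmt16 {n p : ℕ} (hn : 1 ≤ n) (hpn : p ≤ n) :
    -- monomial forms are eigenvectors
    (∀ (α : Fin n → ℕ) (J : Finset (Fin n)), J.card = p →
      IsDeg p (monoForm α J) ∧ domBox (monoForm α J) ∧
      boxOp (monoForm α J)
        = fun K z => (((∑ i, α i) + p : ℕ) : ℂ) * monoForm α J K z) ∧
    -- the spectrum of □̃_p is {m + p : m ∈ ℕ}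
    (∀ lam : ℂ,
      (¬ ((∀ v : FormC n, IsDeg p v → MemA2 v →
              ∃! u : FormC n, IsDeg p u ∧ domBox u ∧
                (fun J z => boxOp u J z - lam * u J z) = v) ∧
          (∃ C : ℝ, 0 < C ∧ ∀ v u : FormC n, IsDeg p v → MemA2 v →
              IsDeg p u → domBox u →
              (fun J z => boxOp u J z - lam * u J z) = v →
              formNormSq u ≤ C * formNormSq v)))
        ↔ ∃ m : ℕ, lam = (m : ℂ) + (p : ℂ)) ∧
    -- the eigenspace of m + p has dimension binom(n+m−1,n−1) * binom(n,p)
    (∀ m : ℕ, ∃ b : Fin ((n + m - 1).choose (n - 1) * n.choose p) → FormC n,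
      (∀ i, IsDeg p (b i) ∧ domBox (b i) ∧
        boxOp (b i) = fun K z => ((m + p : ℕ) : ℂ) * b i K z) ∧
      LinearIndependent ℂ b ∧
      (∀ u : FormC n, IsDeg p u → domBox u →
        boxOp u = (fun K z => ((m + p : ℕ) : ℂ) * u K z) →
        u ∈ Submodule.span ℂ (Set.range b))) := by
  have hmono : ∀ (α : Fin n → ℕ) (J : Finset (Fin n)), J.card = p →
      IsDeg p (monoForm α J) ∧ domBox (monoForm α J) ∧
      boxOp (monoForm α J) = fun K z => (((∑ i, α i) + p : ℕ) : ℂ) * monoForm α J K z := by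
    rintro α J rfl
    exact ⟨isDeg_monoForm α J, domBox_monoForm α J, boxOp_monoForm α J⟩
  refine ⟨hmono, fun lam => ⟨fun h => ?_, ?_⟩, fun m => ?_⟩
  · by_contra! hlam
    obtain ⟨K, hK, hb⟩ := exists_le_mul_norm_sub hlam
    exact h ⟨fun v hvp hv => existsUnique_boxOp_sub_eq hb hvp hv, K ^ 2, by positivity,
      fun v u _ hv hup hu he => formNormSq_le_of_boxOp_sub_eq hb hv hup hu.1.1 he⟩
  · rintro ⟨m, rfl⟩ ⟨h, -⟩
    obtain ⟨J, -, hJ⟩ := Finset.exists_subset_card_eq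
      (s := (Finset.univ : Finset (Fin n))) (n := p) (by simpa using hpn)
    have h0 : domBox (0 : FormC n) := domBox_of_memFockSobolev fun _ => memFockSobolev_zero 2
    obtain ⟨hdeg, hdom, hbox⟩ := hmono (Pi.single ⟨0, hn⟩ m) J hJ
    refine monoForm_ne_zero _ J ((h 0 (fun _ _ => rfl) h0.1.1).unique ⟨hdeg, hdom, ?_⟩
      ⟨fun _ _ => rfl, h0, ?_⟩)
    · rw [hbox]
      funext K z
      simp [Finset.sum_pi_single']
    · funext K
      have h1 := hasCoeff_boxOp_sub (u := 0) (c := 0) (fun _ => hasCoeff_zero) (m + p) K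
      simp only [Pi.zero_apply, mul_zero] at h1
      simpa using h1.eq hasCoeff_zero
  · let e := (Finset.equivFinOfCardEq (card_monoFormIndex (p := p) hn m)).symm
    refine ⟨fun i => monoForm (e i).1.1 (e i).1.2, fun i => ?_, ?_, fun u hup hu h => ?_⟩
    · obtain ⟨h1, h2⟩ := mem_monoFormIndex.mp (e i).2
      have h3 := hmono (e i).1.1 (e i).1.2 h2
      rwa [h1] at h3
    · refine linearIndependent_monoForm.comp (fun i => (⇑(e i).1.1, (e i).1.2)) fun i j hij => ?_
      simp only [Prod.mk.injEq] at hij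
      exact e.injective (Subtype.ext (Prod.ext (DFunLike.coe_injective hij.1) hij.2))
    · obtain ⟨c, hc⟩ := hu.1.1.exists_hasCoeff
      rw [eq_sum_monoForm_of_boxOp_eq hup hc h]
      refine Submodule.sum_mem _ fun q hq => Submodule.smul_mem _ _ (Submodule.subset_span ?_)
      exact ⟨e.symm ⟨q, hq⟩, by simp⟩
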